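/- Let K₁ ∈ ℝ satisfy ‖∇_{(x,a)}h(q,x,a)‖ ≤ K₁ for all (q,x,a) ∈ Ω. Fix (x₀,a₀) ∈ Δ × I and define iterates as follows: for each k ≥ 0, choose q_k ∈ [q₀−ε, q₀+ε] with h(q_k, x_k, a_k) = J(x_k, a_k), set η_k = 2/(λ_M(1−q₀−ε)(k+1)), let (u,v) = (x_k, a_k) − η_k·∇_{(x,a)}h(q_k, x_k, a_k), let x_{k+1} be the unique point of Δ minimizing the Euclidean distance to u, and let a_{k+1} be the point of I nearest to v. Then for every T ≥ 1, J( ∑_{k=1}^T (2k/(T(T+1)))·(x_k, a_k) ) − min_{(x,a) ∈ Δ × I} J(x,a) ≤ 2K₁²/(λ_M(1−q₀−ε)(T+1)). -/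

import Mathlib

open Matrix

noncomputable section

/-- `ℝ^d` with the Euclidean inner product and norm. -/
abbrev E (d : ℕ) := EuclideanSpace ℝ (Fin d)

/-- `ℝ^d × ℝ` equipped with the Euclidean (`L²`) product norm. -/
abbrev Pair (d : ℕ) := WithLp 2 (E d × ℝ)

/-- the standard simplex `Δ`. -/
def simplexSet (d : ℕ) : Set (E d) := {x | (∀ i, 0 ≤ x i) ∧ ∑ i, x i = 1}

/-- `S(x,a) = sqrt(xᵀΣ_S x + (xᵀμ_S − (2a+γ)/2)²)`. -/
def Sfn (d : ℕ) (SigS : Matrix (Fin d) (Fin d) ℝ) (μS : E d) (γ : ℝ)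
    (x : E d) (a : ℝ) : ℝ :=
  Real.sqrt (x ⬝ᵥ SigS.mulVec x + (x ⬝ᵥ μS - (2 * a + γ) / 2) ^ 2)

/-- `V(q,x,a) = (r(q)‖x‖ + S(x,a))² − aγ − γ²/4`. -/
def Vfn (d : ℕ) (SigS : Matrix (Fin d) (Fin d) ℝ) (μS : E d) (γ : ℝ) (r : ℝ → ℝ)
    (q : ℝ) (x : E d) (a : ℝ) : ℝ :=
  (r q * ‖x‖ + Sfn d SigS μS γ x a) ^ 2 - a * γ - γ ^ 2 / 4

/-- `e_N(x,a) = xᵀΣ_N x + (xᵀμ_N − a)² − γ·xᵀμ_N`. -/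
def eNfn (d : ℕ) (SigN : Matrix (Fin d) (Fin d) ℝ) (μN : E d) (γ : ℝ)
    (x : E d) (a : ℝ) : ℝ :=
  x ⬝ᵥ SigN.mulVec x + (x ⬝ᵥ μN - a) ^ 2 - γ * (x ⬝ᵥ μN)

/-- `h(q,x,a) = (1−q)·e_N(x,a) + q·V(q,x,a)`. -/
def hfn (d : ℕ) (SigN SigS : Matrix (Fin d) (Fin d) ℝ) (μN μS : E d) (γ : ℝ) (r : ℝ → ℝ)
    (q : ℝ) (x : E d) (a : ℝ) : ℝ :=
  (1 - q) * eNfn d SigN μN γ x a + q * Vfn d SigS μS γ r q x a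

/-- `J(x,a) = max_{q ∈ [q₀−ε, q₀+ε]} h(q,x,a)`. -/
def Jfn (d : ℕ) (SigN SigS : Matrix (Fin d) (Fin d) ℝ) (μN μS : E d) (γ : ℝ) (r : ℝ → ℝ)
    (q₀ ε : ℝ) (x : E d) (a : ℝ) : ℝ :=
  sSup ((fun q => hfn d SigN SigS μN μS γ r q x a) '' Set.Icc (q₀ - ε) (q₀ + ε))

/-- the pair `(x,a)` as an element of the `L²` product space. -/
def mkPair (d : ℕ) (x : E d) (a : ℝ) : Pair d := (WithLp.equiv 2 (E d × ℝ)).symm (x, a)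

/-- gradient `∇_{(x,a)} h(q,·,·)` in the joint variable `(x,a)`. -/
def gradh (d : ℕ) (SigN SigS : Matrix (Fin d) (Fin d) ℝ) (μN μS : E d) (γ : ℝ) (r : ℝ → ℝ)
    (q : ℝ) (pt : Pair d) : Pair d :=
  gradient (fun y : Pair d =>
    hfn d SigN SigS μN μS γ r q (WithLp.equiv 2 (E d × ℝ) y).1
      (WithLp.equiv 2 (E d × ℝ) y).2) pt

/-- `lam` is the smallest eigenvalue of the symmetric matrix `M`, characterized as the
largest constant `t` with `zᵀMz ≥ t‖z‖²` for all `z` (Rayleigh quotient). -/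
def IsSmallestEigen {n : Type*} [Fintype n] (M : Matrix n n ℝ) (lam : ℝ) : Prop :=
  IsGreatest {t : ℝ | ∀ z : n → ℝ, t * (z ⬝ᵥ z) ≤ z ⬝ᵥ M.mulVec z} lam

/-- the `(d+1)×(d+1)` block matrix `M = [[Σ_N + μ_N μ_Nᵀ, −μ_N], [−μ_Nᵀ, 1]]`. -/
def Mblock (d : ℕ) (SigN : Matrix (Fin d) (Fin d) ℝ) (μN : E d) :
    Matrix (Fin d ⊕ Unit) (Fin d ⊕ Unit) ℝ :=
  Matrix.fromBlocks (SigN + vecMulVec μN μN) (fun i (_ : Unit) => -μN i)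
    (fun (_ : Unit) j => -μN j) 1

lemma aux_proj {F : Type*} [NormedAddCommGroup F] [InnerProductSpace ℝ F] {K : Set F}
    (hK : Convex ℝ K) {u v : F} (hv : v ∈ K) (h : ∀ w ∈ K, ‖v - u‖ ≤ ‖w - u‖) {w : F}
    (hw : w ∈ K) : ‖v - w‖ ^ 2 ≤ ‖u - w‖ ^ 2 := by
  have : Nonempty K := ⟨⟨v, hv⟩⟩
  have h1 : ‖u - v‖ = ⨅ w : K, ‖u - w‖ := by
    apply le_antisymm
    · apply le_ciInf
      rintro ⟨w, hw⟩
      rw [norm_sub_rev u v, norm_sub_rev u]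
      exact h w hw
    · exact ciInf_le ⟨0, by rintro _ ⟨w, rfl⟩; positivity⟩ (⟨v, hv⟩ : K)
  have h2 := (norm_eq_iInf_iff_real_inner_le_zero hK hv).1 h1 w hw
  have h3 : u - w = (u - v) - (w - v) := by abel
  rw [h3, norm_sub_sq_real (u - v), norm_sub_rev v w]
  nlinarith [sq_nonneg ‖u - v‖]

lemma aux_grad_convex {F : Type*} [NormedAddCommGroup F] [InnerProductSpace ℝ F] [CompleteSpace F]
    {f : F → ℝ} (hf : ConvexOn ℝ Set.univ f) {z g : F} (hg : HasGradientAt f g z) (y : F) :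
    f z + inner ℝ g (y - z) ≤ f y := by
  have h1 : ConvexOn ℝ Set.univ (fun t : ℝ => f (AffineMap.lineMap z y t)) := by
    have := hf.comp_affineMap (AffineMap.lineMap z y : ℝ →ᵃ[ℝ] F)
    simpa [Function.comp_def] using! this
  have h2 : HasDerivAt (fun t : ℝ => f (AffineMap.lineMap z y t)) (inner ℝ g (y - z)) 0 := by
    have ha : HasDerivAt (fun t : ℝ => (AffineMap.lineMap z y t : F)) (y - z) 0 :=
      AffineMap.hasDerivAt_lineMap
    have hb : HasFDerivAt f (InnerProductSpace.toDual ℝ F g) (AffineMap.lineMap z y (0:ℝ)) := by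
      simpa using hg.hasFDerivAt
    have := hb.comp_hasDerivAt (0:ℝ) ha
    simpa [Function.comp_def] using this
  have h3 := h1.le_slope_of_hasDerivAt (Set.mem_univ (0:ℝ)) (Set.mem_univ (1:ℝ)) one_pos h2
  simp [slope_def_field] at h3
  linarith

lemma aux_grad_strong {F : Type*} [NormedAddCommGroup F] [InnerProductSpace ℝ F] [CompleteSpace F]
    {f : F → ℝ} {m : ℝ} (hf : StrongConvexOn Set.univ m f) {z : F} (hd : DifferentiableAt ℝ f z)
    (y : F) :
    f z + inner ℝ (gradient f z) (y - z) + m / 2 * ‖y - z‖ ^ 2 ≤ f y := by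
  have h1 := strongConvexOn_iff_convex.1 hf
  have h2 : HasGradientAt (fun x => f x - m / (2 : ℝ) * ‖x‖ ^ 2) (gradient f z - m • z) z := by
    rw [hasGradientAt_iff_hasFDerivAt]
    have ha := hd.hasGradientAt.hasFDerivAt
    have hb := ((hasStrictFDerivAt_norm_sq z).hasFDerivAt).const_mul (m / 2)
    have e : InnerProductSpace.toDual ℝ F (gradient f z - m • z)
        = InnerProductSpace.toDual ℝ F (gradient f z) - (m / 2) • 2 • (innerSL ℝ) z := by
      ext w
      simp [inner_sub_left, inner_smul_left]
      ring
    rw [e]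
    exact ha.sub hb
  have h3 := aux_grad_convex h1 h2 y
  have h4 : ‖y - z‖ ^ 2 = ‖y‖ ^ 2 - 2 * inner ℝ z y + ‖z‖ ^ 2 := by
    rw [norm_sub_sq_real, real_inner_comm]
  rw [h4]
  have h5 : inner ℝ (gradient f z - m • z) (y - z)
      = inner ℝ (gradient f z) (y - z) - m * (inner ℝ z y - ‖z‖ ^ 2) := by
    rw [inner_sub_left, inner_smul_left, inner_sub_right z, real_inner_self_eq_norm_sq]
    simp
  rw [h5] at h3
  nlinarith

/-- abstract telescoping -/
lemma aux_tele (c K : ℝ) (hc : 0 < c) (D φ : ℕ → ℝ) (hD : ∀ k, 0 ≤ D k)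
    (h : ∀ k, D (k + 1) ≤ D k - 2 * (2 / (c * ((k : ℝ) + 1))) * (φ k + c / 2 * D k)
      + (2 / (c * ((k : ℝ) + 1))) ^ 2 * K ^ 2) (T : ℕ) (hT : 1 ≤ T) :
    ∑ k ∈ Finset.Icc 1 T, (2 * (k : ℝ) / ((T : ℝ) * ((T : ℝ) + 1))) * φ k
      ≤ 2 * K ^ 2 / (c * ((T : ℝ) + 1)) := by
  have key : ∀ k : ℕ, (k : ℝ) * φ k ≤ c / 4 * (((k : ℝ) - 1) * k * D k - k * (k + 1) * D (k + 1))
      + K ^ 2 / c := by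
    intro k
    have hk : (0 : ℝ) < (k : ℝ) + 1 := by positivity
    have hk0 : (0 : ℝ) ≤ k := by positivity
    have h1 := h k
    have h2 : c * k * (k + 1) / 4 * D (k + 1) ≤ c * k * (k + 1) / 4 *
      (D k - 2 * (2 / (c * ((k : ℝ) + 1))) * (φ k + c / 2 * D k)
      + (2 / (c * ((k : ℝ) + 1))) ^ 2 * K ^ 2) := by
      apply mul_le_mul_of_nonneg_left h1; positivity
    have h3 : c * k * (k + 1) / 4 *
      (D k - 2 * (2 / (c * ((k : ℝ) + 1))) * (φ k + c / 2 * D k)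
      + (2 / (c * ((k : ℝ) + 1))) ^ 2 * K ^ 2) = c * k * (k + 1) / 4 * D k - k * (φ k + c / 2 * D k)
        + (k / (k + 1)) * (K ^ 2 / c) := by
      field_simp
      ring
    have h4 : (k / (k + 1)) * (K ^ 2 / c) ≤ 1 * (K ^ 2 / c) := by
      apply mul_le_mul_of_nonneg_right _ (by positivity)
      rw [div_le_one hk]; linarith
    rw [h3] at h2
    nlinarith
  have hsum : ∀ T : ℕ, ∑ k ∈ Finset.Icc 1 T, (k : ℝ) * φ k
      ≤ T * (K ^ 2 / c) - c / 4 * (T * (T + 1) * D (T + 1)) := by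
    intro T
    induction T with
    | zero => simp
    | succ n ih =>
      rw [Finset.sum_Icc_succ_top (by omega)]
      have := key (n + 1)
      push_cast at this ⊢
      nlinarith
  have hT' : (0 : ℝ) < T := by exact_mod_cast hT
  have h5 : ∑ k ∈ Finset.Icc 1 T, (2 * (k : ℝ) / ((T : ℝ) * ((T : ℝ) + 1))) * φ k
      = 2 / ((T : ℝ) * ((T : ℝ) + 1)) * ∑ k ∈ Finset.Icc 1 T, (k : ℝ) * φ k := by
    rw [Finset.mul_sum]
    apply Finset.sum_congr rfl
    intro k _
    ring
  have h6 : ∑ k ∈ Finset.Icc 1 T, (k : ℝ) * φ k ≤ T * (K ^ 2 / c) := by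
    have : 0 ≤ c / 4 * (T * (T + 1) * D (T + 1)) := by
      have := hD (T + 1); positivity
    linarith [hsum T]
  rw [h5]
  calc _ ≤ 2 / ((T : ℝ) * ((T : ℝ) + 1)) * (T * (K ^ 2 / c)) :=
        mul_le_mul_of_nonneg_left h6 (by positivity)
    _ = _ := by field_simp

lemma aux_wsum (T : ℕ) (hT : 1 ≤ T) :
    ∑ k ∈ Finset.Icc 1 T, (2 * (k : ℝ) / ((T : ℝ) * ((T : ℝ) + 1))) = 1 := by
  have h : ∀ T : ℕ, ∑ k ∈ Finset.Icc 1 T, (2 * (k : ℝ)) = T * (T + 1) := by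
    intro T
    induction T with
    | zero => simp
    | succ n ih =>
      rw [Finset.sum_Icc_succ_top (by omega), ih]; push_cast; ring
  rw [← Finset.sum_div, h]
  have hT' : (0 : ℝ) < T := by exact_mod_cast hT
  field_simp

lemma aux_simplex_convex (d : ℕ) : Convex ℝ (simplexSet d) := by
  intro x hx y hy s t hs ht hst
  refine ⟨fun i => ?_, ?_⟩
  · have := hx.1 i; have := hy.1 i
    simp; positivity
  · simp [Finset.sum_add_distrib, ← Finset.mul_sum, hx.2, hy.2, hst]

lemma aux_simplex_ne (d : ℕ) {x : E d} (hx : x ∈ simplexSet d) : x ≠ 0 := by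
  rintro rfl
  have := hx.2
  simp at this

lemma aux_S_norm (d : ℕ) (SigS : Matrix (Fin d) (Fin d) ℝ) (hPDS : SigS.PosDef) (μS : E d) (γ : ℝ) :
    ∀ x x' : E d, ∀ a a' s t : ℝ, 0 ≤ s → 0 ≤ t → s + t = 1 →
      Sfn d SigS μS γ (s • x + t • x') (s * a + t * a')
        ≤ s * Sfn d SigS μS γ x a + t * Sfn d SigS μS γ x' a' := by
  obtain ⟨B, hB⟩ : ∃ B : Matrix (Fin d) (Fin d) ℝ, SigS = Bᵀ * B := by
    open scoped MatrixOrder Matrix.Norms.L2Operator in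
    obtain ⟨B, hB⟩ := CStarAlgebra.nonneg_iff_eq_star_mul_self.mp hPDS.posSemidef.nonneg
    exact ⟨B, by simpa [star_eq_conjTranspose] using hB⟩
  let Φ : E d → ℝ → Pair d := fun x a =>
    WithLp.toLp 2 (WithLp.toLp 2 (B.mulVec x), x ⬝ᵥ μS - (2 * a + γ) / 2)
  have hΦ : ∀ x a, Sfn d SigS μS γ x a = ‖Φ x a‖ := by
    intro x a
    rw [Sfn, WithLp.prod_norm_eq_of_L2, EuclideanSpace.norm_sq_eq]
    congr 2
    · rw [hB, ← Matrix.mulVec_mulVec, Matrix.dotProduct_mulVec, Matrix.vecMul_transpose]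
      simp [Φ, dotProduct, sq]
    · simp [Φ]
  intro x x' a a' s t hs ht hst
  rw [hΦ, hΦ, hΦ]
  have : Φ (s • x + t • x') (s * a + t * a') = s • Φ x a + t • Φ x' a' := by
    obtain rfl := eq_sub_of_add_eq hst
    apply (WithLp.equiv 2 _).injective
    apply Prod.ext
    · ext i
      simp [Φ, Matrix.mulVec_add, Matrix.mulVec_smul]
    · simp [Φ, add_dotProduct]
      ring
  rw [this]
  refine (norm_add_le _ _).trans ?_
  rw [norm_smul, norm_smul, Real.norm_of_nonneg hs, Real.norm_of_nonneg ht]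

lemma aux_V_convex (d : ℕ) (SigS : Matrix (Fin d) (Fin d) ℝ) (hPDS : SigS.PosDef) (μS : E d) (γ : ℝ)
    (r : ℝ → ℝ) (hrpos : ∀ q, 0 ≤ r q) (q : ℝ)
    (x x' : E d) (a a' s t : ℝ) (hs : 0 ≤ s) (ht : 0 ≤ t) (hst : s + t = 1) :
      Vfn d SigS μS γ r q (s • x + t • x') (s * a + t * a')
        ≤ s * Vfn d SigS μS γ r q x a + t * Vfn d SigS μS γ r q x' a' := by
  have h1 := aux_S_norm d SigS hPDS μS γ x x' a a' s t hs ht hst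
  have h2 : ‖s • x + t • x'‖ ≤ s * ‖x‖ + t * ‖x'‖ := by
    refine (norm_add_le _ _).trans ?_
    rw [norm_smul, norm_smul, Real.norm_of_nonneg hs, Real.norm_of_nonneg ht]
  have h3 := mul_le_mul_of_nonneg_left h2 (hrpos q)
  have h0 : 0 ≤ Sfn d SigS μS γ (s • x + t • x') (s * a + t * a') := Real.sqrt_nonneg _
  have h4 := mul_nonneg (hrpos q) (norm_nonneg (s • x + t • x'))
  unfold Vfn
  set P := r q * ‖x‖ + Sfn d SigS μS γ x a
  set P' := r q * ‖x'‖ + Sfn d SigS μS γ x' a'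
  have h5 : (r q * ‖s • x + t • x'‖ + Sfn d SigS μS γ (s • x + t • x') (s * a + t * a')) ^ 2
      ≤ (s * P + t * P') ^ 2 := by
    apply pow_le_pow_left₀ (by positivity)
    simp only [P, P']
    nlinarith
  have h6 : (s * P + t * P') ^ 2 ≤ s * P ^ 2 + t * P' ^ 2 := by
    obtain rfl := eq_sub_of_add_eq hst
    nlinarith [mul_nonneg (mul_nonneg hs ht) (sq_nonneg (P - P'))]
  have h7 : γ ^ 2 / 4 = s * (γ ^ 2 / 4) + t * (γ ^ 2 / 4) := by rw [← add_mul, hst, one_mul]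
  nlinarith

lemma aux_eN (d : ℕ) (SigN : Matrix (Fin d) (Fin d) ℝ) (hSymN : SigN.IsSymm) (μN : E d) (γ : ℝ)
    (lamM : ℝ) (hlamM : IsSmallestEigen (Mblock d SigN μN) lamM)
    (x x' : E d) (a a' s t : ℝ) (hs : 0 ≤ s) (ht : 0 ≤ t) (hst : s + t = 1) :
      eNfn d SigN μN γ (s • x + t • x') (s * a + t * a')
        ≤ s * eNfn d SigN μN γ x a + t * eNfn d SigN μN γ x' a'
          - s * t * (lamM * (‖x - x'‖ ^ 2 + (a - a') ^ 2)) := by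
  have h1 := hlamM.1 (Sum.elim (x - x' : E d) (fun _ => a - a'))
  have h2 : (Sum.elim (x - x' : E d) (fun _ : Unit => a - a')) ⬝ᵥ
      (Sum.elim (x - x' : E d) (fun _ => a - a')) = ‖x - x'‖ ^ 2 + (a - a') ^ 2 := by
    rw [EuclideanSpace.norm_sq_eq]
    simp [dotProduct, sq]
  have h3 : (Sum.elim (x - x' : E d) (fun _ : Unit => a - a')) ⬝ᵥ
      (Mblock d SigN μN).mulVec (Sum.elim (x - x' : E d) (fun _ => a - a'))
      = (x - x' : E d) ⬝ᵥ SigN.mulVec (x - x' : E d) + ((x - x' : E d) ⬝ᵥ μN - (a - a')) ^ 2 := by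
    have e1 : (Matrix.of fun i (_ : Unit) => -μN i) *ᵥ (fun _ : Unit => a - a') = (-(a - a')) • (μN : Fin d → ℝ) := by
      ext i; simp [mulVec, dotProduct]; ring
    have e2 : (Matrix.of fun (_ : Unit) j => -μN j) *ᵥ ((x - x' : E d) : Fin d → ℝ) = fun _ => -((x - x' : E d) ⬝ᵥ μN) := by
      ext i; simp only [mulVec, dotProduct, Matrix.of_apply, ← Finset.sum_neg_distrib]
      exact Finset.sum_congr rfl fun i _ => by ring
    have e3 : (vecMulVec (μN : Fin d → ℝ) μN) *ᵥ ((x - x' : E d) : Fin d → ℝ) = ((x - x' : E d) ⬝ᵥ μN) • (μN : Fin d → ℝ) := by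
      ext i; simp only [mulVec, dotProduct, vecMulVec_apply, Pi.smul_apply, smul_eq_mul, Finset.sum_mul]
      exact Finset.sum_congr rfl fun i _ => by ring
    rw [show Mblock d SigN μN = Matrix.fromBlocks (SigN + vecMulVec (μN : Fin d → ℝ) μN)
      (Matrix.of fun i (_ : Unit) => -μN i) (Matrix.of fun (_ : Unit) j => -μN j) 1 from rfl,
      Matrix.fromBlocks_mulVec]
    simp only [Sum.elim_comp_inl, Sum.elim_comp_inr]
    rw [e1, e2, Matrix.add_mulVec, e3, Matrix.one_mulVec, sumElim_dotProduct_sumElim,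
      dotProduct_add, dotProduct_add, dotProduct_smul, dotProduct_smul]
    generalize ((x - x' : E d) : Fin d → ℝ) = w
    simp [dotProduct]
    ring
  rw [h2, h3] at h1
  have hsym : (x' : Fin d → ℝ) ⬝ᵥ SigN.mulVec x = x ⬝ᵥ SigN.mulVec x' := by
    rw [Matrix.dotProduct_mulVec, ← Matrix.mulVec_transpose, hSymN, dotProduct_comm]
  have hk := mul_le_mul_of_nonneg_left h1 (mul_nonneg hs ht)
  refine le_trans (le_of_eq ?_) (sub_le_sub_left hk _)
  unfold eNfn
  obtain rfl := eq_sub_of_add_eq hst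
  simp only [WithLp.ofLp_add, WithLp.ofLp_smul, WithLp.ofLp_sub, mulVec_add, mulVec_smul, mulVec_sub, add_dotProduct, sub_dotProduct,
    dotProduct_add, dotProduct_sub, smul_dotProduct, dotProduct_smul, smul_eq_mul, hsym]
  ring

lemma aux_h_strong (d : ℕ) (γ : ℝ) (μN μS : E d) (SigN SigS : Matrix (Fin d) (Fin d) ℝ)
    (hSymN : SigN.IsSymm) (hPDS : SigS.PosDef)
    (r : ℝ → ℝ) (hrpos : ∀ q, 0 ≤ r q)
    (lamM : ℝ) (hlamM : IsSmallestEigen (Mblock d SigN μN) lamM) (hlamMpos : 0 < lamM)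
    (q m : ℝ) (hq : 0 ≤ q) (hq1 : q ≤ 1) (hm : m ≤ lamM * (1 - q)) :
    StrongConvexOn Set.univ m (fun y : Pair d =>
      hfn d SigN SigS μN μS γ r q (WithLp.equiv 2 (E d × ℝ) y).1
      (WithLp.equiv 2 (E d × ℝ) y).2) := by
  refine ⟨convex_univ, ?_⟩
  intro y _ y' _ s t hs ht hst
  have h1 := aux_eN d SigN hSymN μN γ lamM hlamM y.fst y'.fst y.snd y'.snd s t hs ht hst
  have h2 := aux_V_convex d SigS hPDS μS γ r hrpos q y.fst y'.fst y.snd y'.snd s t hs ht hst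
  have h3 : ‖y - y'‖ ^ 2 = ‖y.fst - y'.fst‖ ^ 2 + (y.snd - y'.snd) ^ 2 := by
    rw [WithLp.prod_norm_sq_eq_of_L2]; simp
  have h4 : 0 ≤ ‖y - y'‖ ^ 2 := by positivity
  rw [← h3] at h1
  have h5 := mul_le_mul_of_nonneg_left h1 (sub_nonneg.2 hq1)
  have h6 := mul_le_mul_of_nonneg_left h2 hq
  have h7 : s * t * (m / 2 * ‖y - y'‖ ^ 2) ≤ s * t * (lamM * (1 - q) * ‖y - y'‖ ^ 2) := by
    apply mul_le_mul_of_nonneg_left _ (mul_nonneg hs ht)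
    apply mul_le_mul_of_nonneg_right _ h4
    nlinarith [mul_nonneg hlamMpos.le (sub_nonneg.2 hq1)]
  change hfn d SigN SigS μN μS γ r q (s • y.fst + t • y'.fst) (s * y.snd + t * y'.snd) ≤
    s * hfn d SigN SigS μN μS γ r q y.fst y.snd + t * hfn d SigN SigS μN μS γ r q y'.fst y'.snd
      - s * t * (m / 2 * ‖y - y'‖ ^ 2)
  unfold hfn
  nlinarith

lemma aux_h_diff (d : ℕ) (γ : ℝ) (μN μS : E d) (SigN SigS : Matrix (Fin d) (Fin d) ℝ)
    (hPDS : SigS.PosDef) (r : ℝ → ℝ) (q : ℝ) (z : Pair d) (hz : z.fst ≠ 0) :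
    DifferentiableAt ℝ (fun y : Pair d =>
      hfn d SigN SigS μN μS γ r q (WithLp.equiv 2 (E d × ℝ) y).1
      (WithLp.equiv 2 (E d × ℝ) y).2) z := by
  change DifferentiableAt ℝ (fun y : Pair d => hfn d SigN SigS μN μS γ r q y.fst y.snd) z
  have hf : DifferentiableAt ℝ (fun y : Pair d => y.fst) z :=
    (WithLp.fstL 2 ℝ (E d) ℝ).differentiableAt
  have hs : DifferentiableAt ℝ (fun y : Pair d => y.snd) z :=
    (WithLp.sndL 2 ℝ (E d) ℝ).differentiableAt
  have hc : ∀ i, DifferentiableAt ℝ (fun y : Pair d => y.fst i) z := fun i =>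
    (EuclideanSpace.proj (𝕜 := ℝ) i).differentiableAt.comp z hf
  have hμ : ∀ μ : E d, DifferentiableAt ℝ (fun y : Pair d => y.fst ⬝ᵥ μ) z := by
    intro μ; unfold dotProduct; fun_prop
  have hQ : ∀ A : Matrix (Fin d) (Fin d) ℝ,
      DifferentiableAt ℝ (fun y : Pair d => y.fst ⬝ᵥ A.mulVec y.fst) z := by
    intro A; unfold mulVec dotProduct; fun_prop
  have hn : DifferentiableAt ℝ (fun y : Pair d => ‖y.fst‖) z := hf.norm ℝ hz
  have hpos : 0 < z.fst ⬝ᵥ SigS.mulVec z.fst := by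
    have := hPDS.dotProduct_mulVec_pos (x := (z.fst : Fin d → ℝ))
      (fun h => hz (by ext i; exact congrFun h i))
    simpa using this
  have h1 := hμ μN
  have h2 := hμ μS
  have h3 := hQ SigN
  have h4 := hQ SigS
  have hS : DifferentiableAt ℝ (fun y : Pair d => Sfn d SigS μS γ y.fst y.snd) z := by
    unfold Sfn
    apply DifferentiableAt.sqrt
    · fun_prop
    · positivity
  unfold hfn eNfn Vfn
  fun_prop

/-- projected subgradient descent with step sizes
`η_k = 2/(λ_M(1−q₀−ε)(k+1))` satisfies
`J(∑_{k=1}^T (2k/(T(T+1)))(x_k,a_k)) − min J ≤ 2K₁²/(λ_M(1−q₀−ε)(T+1))`. -/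
theorem stmt10 (d : ℕ) (hd : 1 ≤ d)
    (γ : ℝ) (hγ : 0 < γ) (μN μS : E d) (SigN SigS : Matrix (Fin d) (Fin d) ℝ)
    (hSymN : SigN.IsSymm) (hPDN : SigN.PosDef) (hSymS : SigS.IsSymm) (hPDS : SigS.PosDef)
    (r : ℝ → ℝ) (hr : ContDiff ℝ 2 r) (hrpos : ∀ q, 0 ≤ r q)
    (q₀ ε : ℝ) (hε : 0 ≤ ε) (hq1 : 0 < q₀ - ε) (hq2 : q₀ + ε < 1)
    (lo hi : ℝ) (hIo : lo ≤ hi)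
    (lamM : ℝ) (hlamM : IsSmallestEigen (Mblock d SigN μN) lamM) (hlamMpos : 0 < lamM)
    (K₁ : ℝ)
    (hK₁ : ∀ q ∈ Set.Icc (q₀ - ε) (q₀ + ε), ∀ x ∈ simplexSet d, ∀ a ∈ Set.Icc lo hi,
      ‖gradh d SigN SigS μN μS γ r q (mkPair d x a)‖ ≤ K₁)
    (x : ℕ → E d) (a : ℕ → ℝ) (qk : ℕ → ℝ)
    (hx0 : x 0 ∈ simplexSet d) (ha0 : a 0 ∈ Set.Icc lo hi)
    (hqk : ∀ k, qk k ∈ Set.Icc (q₀ - ε) (q₀ + ε)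
      ∧ hfn d SigN SigS μN μS γ r (qk k) (x k) (a k)
          = Jfn d SigN SigS μN μS γ r q₀ ε (x k) (a k))
    (hstep : ∀ k : ℕ, ∀ (u : E d) (v : ℝ),
      u = x k - (2 / (lamM * (1 - q₀ - ε) * ((k : ℝ) + 1))) •
            (WithLp.equiv 2 (E d × ℝ)
              (gradh d SigN SigS μN μS γ r (qk k) (mkPair d (x k) (a k)))).1 →
      v = a k - (2 / (lamM * (1 - q₀ - ε) * ((k : ℝ) + 1))) *
            (WithLp.equiv 2 (E d × ℝ)
              (gradh d SigN SigS μN μS γ r (qk k) (mkPair d (x k) (a k)))).2 →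
      (x (k + 1) ∈ simplexSet d ∧ ∀ z ∈ simplexSet d, ‖x (k + 1) - u‖ ≤ ‖z - u‖)
        ∧ (a (k + 1) ∈ Set.Icc lo hi ∧ ∀ b ∈ Set.Icc lo hi, |a (k + 1) - v| ≤ |b - v|)) :
    ∀ T : ℕ, 1 ≤ T →
      Jfn d SigN SigS μN μS γ r q₀ ε
          (∑ k ∈ Finset.Icc 1 T, (2 * (k : ℝ) / ((T : ℝ) * ((T : ℝ) + 1))) • x k)
          (∑ k ∈ Finset.Icc 1 T, (2 * (k : ℝ) / ((T : ℝ) * ((T : ℝ) + 1))) * a k)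
        - sInf ((fun pt : E d × ℝ => Jfn d SigN SigS μN μS γ r q₀ ε pt.1 pt.2) ''
            (simplexSet d ×ˢ Set.Icc lo hi))
        ≤ 2 * K₁ ^ 2 / (lamM * (1 - q₀ - ε) * ((T : ℝ) + 1)) := by
  intro T hT
  set c := lamM * (1 - q₀ - ε) with hc
  have hcpos : 0 < c := mul_pos hlamMpos (by linarith)
  have hmem : ∀ k, x k ∈ simplexSet d ∧ a k ∈ Set.Icc lo hi := by
    intro k
    cases k with
    | zero => exact ⟨hx0, ha0⟩
    | succ k => exact ⟨(hstep k _ _ rfl rfl).1.1, (hstep k _ _ rfl rfl).2.1⟩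
  have hbdd : ∀ (y : E d) (b : ℝ), BddAbove
      ((fun q => hfn d SigN SigS μN μS γ r q y b) '' Set.Icc (q₀ - ε) (q₀ + ε)) := by
    intro y b
    apply IsCompact.bddAbove_image isCompact_Icc
    have := hr.continuous
    unfold hfn Vfn
    fun_prop
  have hJ : ∀ (y : E d) (b q : ℝ), q ∈ Set.Icc (q₀ - ε) (q₀ + ε) →
      hfn d SigN SigS μN μS γ r q y b ≤ Jfn d SigN SigS μN μS γ r q₀ ε y b :=
    fun y b q hq => le_csSup (hbdd y b) ⟨q, hq, rfl⟩
  have hstrong : ∀ q ∈ Set.Icc (q₀ - ε) (q₀ + ε), StrongConvexOn Set.univ c (fun y : Pair d =>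
      hfn d SigN SigS μN μS γ r q (WithLp.equiv 2 (E d × ℝ) y).1
      (WithLp.equiv 2 (E d × ℝ) y).2) := by
    intro q hq
    apply aux_h_strong d γ μN μS SigN SigS hSymN hPDS r hrpos lamM hlamM hlamMpos q c
      (by linarith [hq.1]) (by linarith [hq.2])
    apply mul_le_mul_of_nonneg_left _ hlamMpos.le
    linarith [hq.2]
  set w : ℕ → ℝ := fun k => 2 * (k : ℝ) / ((T : ℝ) * ((T : ℝ) + 1)) with hw
  have hw0 : ∀ k, 0 ≤ w k := fun k => by simp only [hw]; positivity
  have hw1 : ∑ k ∈ Finset.Icc 1 T, w k = 1 := aux_wsum T hT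
  -- Jensen
  have hJen : Jfn d SigN SigS μN μS γ r q₀ ε (∑ k ∈ Finset.Icc 1 T, w k • x k)
      (∑ k ∈ Finset.Icc 1 T, w k * a k)
      ≤ ∑ k ∈ Finset.Icc 1 T, w k * Jfn d SigN SigS μN μS γ r q₀ ε (x k) (a k) := by
    apply csSup_le ((Set.nonempty_Icc.2 (by linarith)).image _)
    rintro _ ⟨q, hq, rfl⟩
    have hconv := ((hstrong q hq).strictConvexOn hcpos).convexOn
    have := hconv.map_sum_le (t := Finset.Icc 1 T) (w := w) (p := fun k => mkPair d (x k) (a k))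
      (fun k _ => hw0 k) hw1 (fun _ _ => Set.mem_univ _)
    have e : ∑ k ∈ Finset.Icc 1 T, w k • mkPair d (x k) (a k)
        = mkPair d (∑ k ∈ Finset.Icc 1 T, w k • x k) (∑ k ∈ Finset.Icc 1 T, w k * a k) := by
      apply (WithLp.linearEquiv 2 ℝ (E d × ℝ)).injective
      rw [map_sum]
      simp only [map_smul]
      apply Prod.ext
      · rw [Prod.fst_sum]; rfl
      · rw [Prod.snd_sum]; rfl
    rw [e] at this
    refine le_trans this ?_
    apply Finset.sum_le_sum
    intro k _
    exact mul_le_mul_of_nonneg_left (hJ (x k) (a k) q hq) (hw0 k)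
  have hmain : ∀ y ∈ simplexSet d, ∀ b ∈ Set.Icc lo hi,
      ∑ k ∈ Finset.Icc 1 T, w k * (Jfn d SigN SigS μN μS γ r q₀ ε (x k) (a k)
        - Jfn d SigN SigS μN μS γ r q₀ ε y b) ≤ 2 * K₁ ^ 2 / (c * ((T : ℝ) + 1)) := by
    intro y hy b hb
    apply aux_tele c K₁ hcpos (fun k => ‖x k - y‖ ^ 2 + (a k - b) ^ 2) _ (fun k => by positivity)
      _ T hT
    intro k
    set η := 2 / (c * ((k : ℝ) + 1)) with hη
    have hηpos : 0 < η := by positivity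
    set g := gradh d SigN SigS μN μS γ r (qk k) (mkPair d (x k) (a k)) with hg
    obtain ⟨⟨hx1, hx2⟩, ha1, ha2⟩ := hstep k _ _ rfl rfl
    have p1 := aux_proj (aux_simplex_convex d) hx1 hx2 hy
    have p2 := aux_proj (convex_Icc lo hi) ha1 (by simpa only [Real.norm_eq_abs] using ha2) hb
    rw [Real.norm_eq_abs, sq_abs, Real.norm_eq_abs, sq_abs] at p2
    change ‖x (k + 1) - y‖ ^ 2 ≤ ‖x k - η • g.fst - y‖ ^ 2 at p1
    change (a (k + 1) - b) ^ 2 ≤ (a k - η * g.snd - b) ^ 2 at p2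
    have hgn : ‖g.fst‖ ^ 2 + g.snd ^ 2 ≤ K₁ ^ 2 := by
      have h1 := hK₁ (qk k) (hqk k).1 (x k) (hmem k).1 (a k) (hmem k).2
      have h2 : ‖g‖ ^ 2 ≤ K₁ ^ 2 := pow_le_pow_left₀ (norm_nonneg _) h1 2
      rw [WithLp.prod_norm_sq_eq_of_L2] at h2
      simpa using h2
    have hgr := aux_grad_strong (hstrong (qk k) (hqk k).1)
      (aux_h_diff d γ μN μS SigN SigS hPDS r (qk k) (mkPair d (x k) (a k))
        (aux_simplex_ne d (hmem k).1)) (mkPair d y b)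
    change hfn d SigN SigS μN μS γ r (qk k) (x k) (a k) + inner ℝ g (mkPair d y b - mkPair d (x k) (a k))
      + c / 2 * ‖mkPair d y b - mkPair d (x k) (a k)‖ ^ 2
      ≤ hfn d SigN SigS μN μS γ r (qk k) y b at hgr
    have hn : ‖mkPair d y b - mkPair d (x k) (a k)‖ ^ 2 = ‖x k - y‖ ^ 2 + (a k - b) ^ 2 := by
      rw [norm_sub_rev, WithLp.prod_norm_sq_eq_of_L2]
      simp [mkPair]
    have hi : inner ℝ g (mkPair d y b - mkPair d (x k) (a k))
        = - (inner ℝ (x k - y) g.fst + (a k - b) * g.snd) := by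
      rw [WithLp.prod_inner_apply, real_inner_comm]
      change inner ℝ (y - x k) g.fst + inner ℝ g.snd (b - a k) = _
      rw [← neg_sub (x k) y, inner_neg_left]
      simp
      ring
    rw [hn, hi, (hqk k).2] at hgr
    have hJy := hJ y b (qk k) (hqk k).1
    have e1 : ‖x k - η • g.fst - y‖ ^ 2
        = ‖x k - y‖ ^ 2 - 2 * η * inner ℝ (x k - y) g.fst + η ^ 2 * ‖g.fst‖ ^ 2 := by
      rw [show x k - η • g.fst - y = (x k - y) - η • g.fst by abel, norm_sub_sq_real,
        inner_smul_right, norm_smul, Real.norm_of_nonneg hηpos.le]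
      ring
    rw [e1] at p1
    have f1 := mul_le_mul_of_nonneg_left hgn (sq_nonneg η)
    have f2 := mul_le_mul_of_nonneg_left (hgr.trans hJy) (by positivity : 0 ≤ 2 * η)
    beta_reduce
    nlinarith
  have hfin : Jfn d SigN SigS μN μS γ r q₀ ε (∑ k ∈ Finset.Icc 1 T, w k • x k)
      (∑ k ∈ Finset.Icc 1 T, w k * a k) - 2 * K₁ ^ 2 / (c * ((T : ℝ) + 1))
      ≤ sInf ((fun pt : E d × ℝ => Jfn d SigN SigS μN μS γ r q₀ ε pt.1 pt.2) ''
            (simplexSet d ×ˢ Set.Icc lo hi)) := by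
    apply le_csInf
    · exact ⟨_, (x 0, a 0), ⟨hx0, ha0⟩, rfl⟩
    · rintro _ ⟨⟨y, b⟩, ⟨hy, hb⟩, rfl⟩
      have := hmain y hy b hb
      simp only [mul_sub, Finset.sum_sub_distrib, ← Finset.sum_mul, hw1, one_mul] at this
      simp only at hJen ⊢
      linarith
  linarith
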